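/- arXiv:2207.00652 — 2 statements merged into one kernel-verified Lean document; each statement's English description precedes it below -/
import Mathlib

section
/- (Multilinear Kakeya, Bennett–Carbery–Tao.) Let n ≥ 2. For each j ∈ {1,…,n} and a ∈ {1,…,A_j}, let ℓ_{j,a} ⊂ ℝ^n be a line whose direction makes angle at most 1/(100n) with the x_j-axis, and let T_{j,a} be the characteristic function of the set of points at distance at most 1 from ℓ_{j,a}. Then for every ε > 0 there is a constant C(n,ε) such that for every R ≥ 1 and every cube B_R ⊂ ℝ^n of side length R, ∫_{B_R} ∏_{j=1}^{n} ( ∑_{a=1}^{A_j} T_{j,a}(x) )^{1/(n−1)} dx ≤ C(n,ε) R^ε ∏_{j=1}^{n} A_j^{1/(n−1)}. -/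
open MeasureTheory

section

variable {n : ℕ}

theorem lmarginal_prod_rpow_le {p : ℝ} (hp : 0 ≤ p) (hpn : ((n : ℝ) - 1) * p = 1)
    {f : Fin n → (Fin n → ℝ) → ENNReal} (hf : ∀ i, Measurable (f i))
    (hind : ∀ i x t, f i (Function.update x i t) = f i x) (s : Finset (Fin n)) (x : Fin n → ℝ) :
    (∫⋯∫⁻_s, fun x => ∏ i, f i x ^ p ∂fun _ => volume) x ≤
      ∏ i, ((∫⋯∫⁻_s.erase i, f i ∂fun _ => volume) x) ^ p := by
  induction s using Finset.induction generalizing x with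
  | empty => simp
  | insert k s hk ih =>
    have hm : ∀ i, Measurable fun t =>
        (∫⋯∫⁻_s.erase i, f i ∂fun _ => volume) (Function.update x k t) := fun i =>
      ((hf i).lmarginal _).comp (measurable_update x)
    rw [lmarginal_insert _ (Finset.measurable_prod _ fun i _ => (hf i).pow_const p) hk]
    calc _ ≤ ∫⁻ t, ∏ i, ((∫⋯∫⁻_s.erase i, f i ∂fun _ => volume) (Function.update x k t)) ^ p :=
          lintegral_mono fun t => ih _
      _ = ∫⁻ t, ((∫⋯∫⁻_s, f k ∂fun _ => volume) x) ^ p * ∏ i ∈ Finset.univ.erase k,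
            ((∫⋯∫⁻_s.erase i, f i ∂fun _ => volume) (Function.update x k t)) ^ p := by
          refine lintegral_congr fun t => ?_
          rw [← Finset.mul_prod_erase _ _ (Finset.mem_univ k), Finset.erase_eq_of_notMem hk,
            lmarginal_update_of_notMem (hf k) hk]
          congr 3
          funext y
          exact hind k y t
      _ ≤ ((∫⋯∫⁻_s, f k ∂fun _ => volume) x) ^ p * ∏ i ∈ Finset.univ.erase k,
            (∫⁻ t, (∫⋯∫⁻_s.erase i, f i ∂fun _ => volume) (Function.update x k t)) ^ p := by
          rw [lintegral_const_mul _ (Finset.measurable_prod _ fun i _ => (hm i).pow_const p)]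
          gcongr
          refine ENNReal.lintegral_prod_norm_pow_le _ (fun i _ => (hm i).aemeasurable) ?_
            fun _ _ => hp
          rw [Finset.sum_const, Finset.card_erase_of_mem (Finset.mem_univ k), Finset.card_univ,
            Fintype.card_fin, nsmul_eq_mul, Nat.cast_sub (by have := k.2; omega), Nat.cast_one, hpn]
      _ = _ := by
          rw [← Finset.mul_prod_erase _ _ (Finset.mem_univ k), Finset.erase_insert hk]
          congr 1
          refine Finset.prod_congr rfl fun i hi => ?_
          rw [Finset.erase_insert_of_ne (Finset.ne_of_mem_erase hi).symm,
            lmarginal_insert _ (hf i) fun h => hk (Finset.mem_of_mem_erase h)]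

theorem loomis_whitney {p : ℝ} (hp : 0 ≤ p) (hpn : ((n : ℝ) - 1) * p = 1)
    {f : Fin n → (Fin n → ℝ) → ENNReal} (hf : ∀ i, Measurable (f i))
    (hind : ∀ i x t, f i (Function.update x i t) = f i x) :
    ∫⁻ x, ∏ i, f i x ^ p ≤
      ∏ i, ((∫⋯∫⁻_Finset.univ.erase i, f i ∂fun _ => volume) 0) ^ p := by
  rw [volume_pi, lintegral_eq_lmarginal_univ (0 : Fin n → ℝ)]
  exact lmarginal_prod_rpow_le hp hpn hf hind _ _

theorem lmarginal_indicator_slab (j : Fin n) (c : Fin n → ℝ) (W : ℝ) :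
    (∫⋯∫⁻_Finset.univ.erase j, ({y : Fin n → ℝ | ∀ i, i ≠ j → |y i - c i| ≤ W}.indicator 1)
      ∂fun _ => volume) 0 = ENNReal.ofReal (2 * W) ^ (n - 1) := by
  have key : ∀ y : (i : (Finset.univ.erase j : Finset (Fin n))) → ℝ,
      ({y : Fin n → ℝ | ∀ i, i ≠ j → |y i - c i| ≤ W}.indicator 1)
        (Function.updateFinset 0 (Finset.univ.erase j) y) =
      ((Set.univ.pi fun i : (Finset.univ.erase j : Finset (Fin n)) =>
        Set.Icc (c i - W) (c i + W)).indicator 1 y : ENNReal) := by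
    intro y
    refine Set.indicator_const_eq_indicator_const (c := (1 : ENNReal)) ?_
    simp only [Set.mem_ofPred_eq, Set.mem_univ_pi, Set.mem_Icc, Function.updateFinset, Subtype.forall,
      Finset.mem_erase, Finset.mem_univ, and_true]
    refine forall_congr' fun i => forall_congr' fun hi => ?_
    rw [dif_pos hi, abs_le]
    constructor <;> rintro ⟨h1, h2⟩ <;> constructor <;> linarith
  rw [lmarginal]
  simp_rw [key]
  rw [lintegral_indicator_one (MeasurableSet.univ_pi fun _ => measurableSet_Icc), Measure.pi_pi]
  simp [Real.volume_Icc, add_sub_sub_cancel, ← two_mul, Finset.card_univ]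

theorem indicator_one_le_indicator_one {α β : Type*} {s : Set α} {t : Set β} {x : α} {y : β}
    (h : x ∈ s → y ∈ t) : s.indicator (1 : α → ENNReal) x ≤ t.indicator 1 y := by
  by_cases hx : x ∈ s
  · simp [hx, h hx]
  · simp [hx]

/-- The tube of sup-norm width `W` around the line `{x | ∀ i ≠ j, x i = q i + x j * s i}`, which is
transverse to the `j`-th coordinate hyperplane and has slopes `s`. -/
def slopeTube (j : Fin n) (q s : Fin n → ℝ) (W : ℝ) : Set (Fin n → ℝ) :=
  {x | ∀ i, i ≠ j → |x i - q i - x j * s i| ≤ W}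

/-- The number of tubes `slopeTube j (q a) (s a) W`, `a ∈ S`, through a point. -/
noncomputable def tubeCount {ι : Type*} (j : Fin n) (S : Finset ι) (q s : ι → Fin n → ℝ) (W : ℝ)
    (x : Fin n → ℝ) : ENNReal :=
  ∑ a ∈ S, (slopeTube j (q a) (s a) W).indicator 1 x

theorem measurableSet_slopeTube (j : Fin n) (q s : Fin n → ℝ) (W : ℝ) :
    MeasurableSet (slopeTube j q s W) := by
  have : slopeTube j q s W = ⋂ i, ⋂ _ : i ≠ j, {x | |x i - q i - x j * s i| ≤ W} := by
    ext x; simp [slopeTube]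
  rw [this]
  exact MeasurableSet.iInter fun i => MeasurableSet.iInter fun _ =>
    measurableSet_le (by fun_prop) measurable_const

theorem measurable_tubeCount {ι : Type*} (j : Fin n) (S : Finset ι) (q s : ι → Fin n → ℝ) (W : ℝ) :
    Measurable (tubeCount j S q s W) :=
  Finset.measurable_fun_sum _ fun _ _ => measurable_one.indicator (measurableSet_slopeTube ..)

theorem lintegral_prod_slab_count_le {p : ℝ} (hp : 0 ≤ p) (hpn : ((n : ℝ) - 1) * p = 1)
    {ι : Fin n → Type*} (S : ∀ j, Finset (ι j)) (c : ∀ j, ι j → Fin n → ℝ) (W : ℝ) :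
    ∫⁻ x, ∏ j, (∑ a ∈ S j,
        {y : Fin n → ℝ | ∀ i, i ≠ j → |y i - c j a i| ≤ W}.indicator 1 x : ENNReal) ^ p ≤
      ENNReal.ofReal (2 * W) ^ n * ∏ j, ((S j).card : ENNReal) ^ p := by
  have hm : ∀ j a, Measurable
      ({y : Fin n → ℝ | ∀ i, i ≠ j → |y i - c j a i| ≤ W}.indicator (1 : (Fin n → ℝ) → ENNReal)) := by
    intro j a
    simpa [slopeTube] using
      (measurable_one (α := ENNReal)).indicator (measurableSet_slopeTube j (c j a) 0 W)
  refine (loomis_whitney hp hpn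
    (fun j => Finset.measurable_fun_sum _ fun a _ => hm j a) ?_).trans ?_
  · intro j x t
    refine Finset.sum_congr rfl fun a _ => Set.indicator_const_eq_indicator_const ?_
    refine forall_congr' fun i => forall_congr' fun hi => ?_
    rw [Function.update_of_ne hi]
  · have hn : ((n - 1 : ℕ) : ℝ) = n - 1 := by
      rcases n.eq_zero_or_pos with rfl | h
      · norm_num at hpn; linarith
      · push_cast [Nat.cast_sub h]; ring
    have key : ∀ j, (∫⋯∫⁻_Finset.univ.erase j, (fun x => ∑ a ∈ S j,
        {y : Fin n → ℝ | ∀ i, i ≠ j → |y i - c j a i| ≤ W}.indicator 1 x) ∂fun _ => volume) 0 ^ p =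
        ENNReal.ofReal (2 * W) * ((S j).card : ENNReal) ^ p := by
      intro j
      rw [lmarginal, lintegral_finsetSum (S j) (f := fun a y =>
        {y : Fin n → ℝ | ∀ i, i ≠ j → |y i - c j a i| ≤ W}.indicator (1 : (Fin n → ℝ) → ENNReal)
          (Function.updateFinset 0 (Finset.univ.erase j) y))
        fun a _ => (hm j a).comp measurable_updateFinset]
      have : ∀ a ∈ S j, _ = _ := fun a _ => lmarginal_indicator_slab j (c j a) W
      simp only [lmarginal] at this
      rw [Finset.sum_congr rfl this, Finset.sum_const, nsmul_eq_mul,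
        ENNReal.mul_rpow_of_nonneg _ _ hp, ← ENNReal.rpow_natCast, ← ENNReal.rpow_mul, hn, hpn,
        ENNReal.rpow_one, mul_comm]
    rw [Finset.prod_congr rfl fun j _ => key j, Finset.prod_mul_distrib]
    simp

/-- The matrix whose `j`-th column is `e_j` plus the off-diagonal part of the slopes `σ j`. -/
def slopeMatrix (σ : Fin n → Fin n → ℝ) : Matrix (Fin n) (Fin n) ℝ :=
  fun i j => if i = j then 1 else σ j i

theorem norm_le_two_mul_norm_slopeMatrix_mulVec {σ : Fin n → Fin n → ℝ}
    (hσ : ∀ j i, |σ j i| ≤ 1 / (2 * n)) (y : Fin n → ℝ) :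
    ‖y‖ ≤ 2 * ‖(slopeMatrix σ).mulVec y‖ := by
  have h : ‖y‖ ≤ ‖(slopeMatrix σ).mulVec y‖ + ‖y‖ / 2 := by
    refine (pi_norm_le_iff_of_nonneg (by positivity)).2 fun i => ?_
    have hn : (0 : ℝ) < n := by exact_mod_cast Fin.pos i
    have e : y i = (slopeMatrix σ).mulVec y i - ∑ j, (if i = j then 0 else σ j i) * y j := by
      rw [Matrix.mulVec, dotProduct, ← Finset.sum_sub_distrib, Finset.sum_eq_single i]
      · simp [slopeMatrix]
      · intro j _ hj
        simp [slopeMatrix, hj.symm]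
      · simp
    rw [e]
    refine (norm_sub_le _ _).trans (add_le_add (norm_le_pi_norm _ i) ?_)
    refine (norm_sum_le _ _).trans ?_
    calc ∑ j, ‖(if i = j then 0 else σ j i) * y j‖ ≤ ∑ j : Fin n, 1 / (2 * n) * ‖y‖ := by
          refine Finset.sum_le_sum fun j _ => ?_
          rw [norm_mul]
          refine mul_le_mul ?_ (norm_le_pi_norm y j) (norm_nonneg _) (by positivity)
          split_ifs
          · simp
          · exact hσ j i
      _ = ‖y‖ / 2 := by
          rw [Finset.sum_const, Finset.card_univ, Fintype.card_fin, nsmul_eq_mul]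
          field_simp
  linarith

theorem slopeMatrix_det_ne_zero {σ : Fin n → Fin n → ℝ} (hσ : ∀ j i, |σ j i| ≤ 1 / (2 * n)) :
    (slopeMatrix σ).det ≠ 0 := by
  intro h
  obtain ⟨y, hy, hy0⟩ := Matrix.exists_mulVec_eq_zero_iff.2 h
  have := norm_le_two_mul_norm_slopeMatrix_mulVec hσ y
  rw [hy0, norm_zero, mul_zero] at this
  exact hy (norm_le_zero_iff.1 this)

theorem abs_slopeMatrix_det_le {σ : Fin n → Fin n → ℝ} (hσ : ∀ j i, |σ j i| ≤ 1 / (2 * n)) :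
    |(slopeMatrix σ).det| ≤ n.factorial := by
  have := Matrix.det_le (A := slopeMatrix σ) (abv := AbsoluteValue.abs) (x := 1) fun i j => by
    have hn : (1 : ℝ) ≤ n := by exact_mod_cast Fin.pos i
    rw [slopeMatrix, AbsoluteValue.abs_apply]
    split_ifs
    · simp
    · refine (hσ j i).trans ?_
      rw [div_le_one (by positivity)]
      linarith
  simpa using this

theorem lintegral_eq_abs_det_mul {M : Matrix (Fin n) (Fin n) ℝ} (hM : M.det ≠ 0)
    {f : (Fin n → ℝ) → ENNReal} (hf : Measurable f) :
    ∫⁻ x, f x = ENNReal.ofReal |M.det| * ∫⁻ y, f (M.mulVec y) := by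
  have hmap : ∫⁻ y, f (M.mulVec y) = ENNReal.ofReal |M.det⁻¹| * ∫⁻ x, f x := by
    have := lintegral_map (μ := (volume : Measure (Fin n → ℝ))) hf
      (LinearMap.continuous_of_finiteDimensional (Matrix.toLin' M)).measurable
    rw [Real.map_matrix_volume_pi_eq_smul_volume_pi hM, lintegral_smul_measure] at this
    simpa using this.symm
  rw [hmap, ← mul_assoc, ← ENNReal.ofReal_mul (abs_nonneg _), ← abs_mul, mul_inv_cancel₀ hM]
  simp

theorem abs_sub_le_of_mulVec_mem_slopeTube {σ : Fin n → Fin n → ℝ}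
    (hσ : ∀ j i, |σ j i| ≤ 1 / (2 * n)) {j : Fin n} {q : Fin n → ℝ} {W : ℝ} (hW : 0 ≤ W)
    {y : Fin n → ℝ} (hy : (slopeMatrix σ).mulVec y ∈ slopeTube j q (σ j) W) {i : Fin n}
    (hi : i ≠ j) : |y i - (slopeMatrix σ)⁻¹.mulVec (Function.update q j 0) i| ≤ 2 * W := by
  set M := slopeMatrix σ with hM
  set q' := M⁻¹.mulVec (Function.update q j 0) with hq'
  have hu : IsUnit M.det := (slopeMatrix_det_ne_zero hσ).isUnit
  set z : Fin n → ℝ := y - q' - M.mulVec y j • Pi.single j 1 with hz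
  have hMz : ‖M.mulVec z‖ ≤ W := by
    have e : M.mulVec z = M.mulVec y - Function.update q j 0 - M.mulVec y j • M.col j := by
      rw [hz, Matrix.mulVec_sub, Matrix.mulVec_sub, Matrix.mulVec_smul, Matrix.mulVec_single_one,
        hq', Matrix.mulVec_mulVec, Matrix.mul_nonsing_inv _ hu, Matrix.one_mulVec]
    refine (pi_norm_le_iff_of_nonneg hW).2 fun k => ?_
    rw [e]
    by_cases hk : k = j
    · subst hk
      simpa [hM, slopeMatrix] using hW
    · simpa [hM, slopeMatrix, hk] using hy k hk
  have h2 := (norm_le_pi_norm z i).trans (norm_le_two_mul_norm_slopeMatrix_mulVec hσ z)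
  have : z i = y i - q' i := by simp [hz, hi]
  rw [this, Real.norm_eq_abs] at h2
  linarith

theorem lintegral_prod_parallel_tubeCount_le {p : ℝ} (hp : 0 ≤ p) (hpn : ((n : ℝ) - 1) * p = 1)
    {ι : Fin n → Type*} (S : ∀ j, Finset (ι j)) (q : ∀ j, ι j → Fin n → ℝ)
    {σ : Fin n → Fin n → ℝ} (hσ : ∀ j i, |σ j i| ≤ 1 / (2 * n)) {W : ℝ} (hW : 0 ≤ W) :
    ∫⁻ x, ∏ j, tubeCount j (S j) (q j) (fun _ => σ j) W x ^ p ≤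
      n.factorial * ENNReal.ofReal (4 * W) ^ n * ∏ j, ((S j).card : ENNReal) ^ p := by
  rw [lintegral_eq_abs_det_mul (slopeMatrix_det_ne_zero hσ)
    (Finset.measurable_fun_prod _ fun j _ => (measurable_tubeCount ..).pow_const p), mul_assoc]
  refine mul_le_mul' ?_ ?_
  · rw [← ENNReal.ofReal_natCast]
    exact ENNReal.ofReal_le_ofReal (abs_slopeMatrix_det_le hσ)
  · rw [show 4 * W = 2 * (2 * W) by ring]
    refine le_trans (lintegral_mono fun y => ?_) (lintegral_prod_slab_count_le hp hpn S
      (fun j a => (slopeMatrix σ)⁻¹.mulVec (Function.update (q j a) j 0)) (2 * W))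
    refine Finset.prod_le_prod' fun j _ => ENNReal.rpow_le_rpow ?_ hp
    refine Finset.sum_le_sum fun a _ => ?_
    exact indicator_one_le_indicator_one fun hy i hi =>
      abs_sub_le_of_mulVec_mem_slopeTube hσ hW hy hi

theorem tubeCount_le_card {ι : Type*} (j : Fin n) (S : Finset ι) (q s : ι → Fin n → ℝ) (W : ℝ)
    (x : Fin n → ℝ) : tubeCount j S q s W x ≤ S.card := by
  refine (Finset.sum_le_card_nsmul S _ 1 fun a _ => ?_).trans (by simp)
  exact Set.indicator_le_self' (fun _ _ => zero_le) x

/-- The half-open cube with corner `c` and side length `ℓ`. -/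
def cornerCube (c : Fin n → ℝ) (ℓ : ℝ) : Set (Fin n → ℝ) :=
  Set.univ.pi fun i => Set.Ico (c i) (c i + ℓ)

theorem measurableSet_cornerCube (c : Fin n → ℝ) (ℓ : ℝ) : MeasurableSet (cornerCube c ℓ) :=
  MeasurableSet.univ_pi fun _ => measurableSet_Ico

theorem volume_cornerCube (c : Fin n → ℝ) (ℓ : ℝ) :
    volume (cornerCube c ℓ) = ENNReal.ofReal ℓ ^ n := by
  simp [cornerCube, volume_pi_pi]

theorem lintegral_cornerCube_eq_sum (D : ℕ) (c : Fin n → ℝ) {ℓ : ℝ} (hℓ : 0 < ℓ)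
    (f : (Fin n → ℝ) → ENNReal) :
    ∫⁻ x in cornerCube c (D * ℓ), f x =
      ∑ k : Fin n → Fin D, ∫⁻ x in cornerCube (fun i => c i + (k i : ℕ) * ℓ) ℓ, f x := by
  have hfloor : ∀ {c x : ℝ} {k : ℕ}, x ∈ Set.Ico (c + k * ℓ) (c + k * ℓ + ℓ) ↔
      c ≤ x ∧ ⌊(x - c) / ℓ⌋₊ = k := by
    intro c x k
    constructor
    · rintro ⟨h1, h2⟩
      have hc : c ≤ x := by nlinarith [mul_nonneg (Nat.cast_nonneg (α := ℝ) k) hℓ.le]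
      refine ⟨hc, (Nat.floor_eq_iff (by have := sub_nonneg.2 hc; positivity)).2 ⟨?_, ?_⟩⟩
      · rw [le_div_iff₀ hℓ]; linarith
      · rw [div_lt_iff₀ hℓ]; linarith
    · rintro ⟨hc, h⟩
      obtain ⟨h1, h2⟩ := (Nat.floor_eq_iff (by have := sub_nonneg.2 hc; positivity)).1 h
      rw [le_div_iff₀ hℓ] at h1
      rw [div_lt_iff₀ hℓ] at h2
      constructor <;> linarith
  rw [← lintegral_biUnion_finset]
  · congr 2
    ext x
    simp only [cornerCube, Set.mem_univ_pi, Set.mem_iUnion, Finset.mem_univ, exists_true_left,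
      hfloor]
    constructor
    · intro h
      refine ⟨fun i => ⟨⌊(x i - c i) / ℓ⌋₊, ?_⟩, fun i => ⟨(h i).1, rfl⟩⟩
      have h1 := sub_nonneg.2 (h i).1
      rw [Nat.floor_lt (by positivity), div_lt_iff₀ hℓ]
      linarith [(h i).2]
    · rintro ⟨k, hk⟩ i
      refine ⟨(hk i).1, ?_⟩
      have h1 := sub_nonneg.2 (hk i).1
      have h2 := (k i).2
      rw [← (hk i).2, Nat.floor_lt (by positivity), div_lt_iff₀ hℓ] at h2
      linarith
  · intro k _ l _ hkl
    refine Set.disjoint_left.2 fun x hx hx' => hkl ?_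
    simp only [cornerCube, Set.mem_univ_pi, hfloor] at hx hx'
    exact funext fun i => Fin.ext ((hx i).2.symm.trans (hx' i).2)
  · exact fun _ _ => measurableSet_cornerCube _ _

theorem setLIntegral_prod_tubeCount_le_of_slopes_near {p : ℝ} (hp : 0 ≤ p)
    (hpn : ((n : ℝ) - 1) * p = 1) {ι : Fin n → Type*} (S : ∀ j, Finset (ι j))
    (q s : ∀ j, ι j → Fin n → ℝ) {σ : Fin n → Fin n → ℝ} (hσ : ∀ j i, |σ j i| ≤ 1 / (2 * n))
    {δ ℓ W : ℝ} (hs : ∀ j, ∀ a ∈ S j, ∀ i, |s j a i - σ j i| ≤ δ) (hδ : 0 ≤ δ) (hℓ : 0 ≤ ℓ)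
    (hW : δ * ℓ ≤ W) (c : Fin n → ℝ) :
    ∫⁻ x in cornerCube c ℓ, ∏ j, tubeCount j (S j) (q j) (s j) W x ^ p ≤
      n.factorial * ENNReal.ofReal (8 * W) ^ n * ∏ j, ((S j).card : ENNReal) ^ p := by
  have hW0 : 0 ≤ W := (mul_nonneg hδ hℓ).trans hW
  have h := lintegral_prod_parallel_tubeCount_le hp hpn S
    (fun j a i => q j a i + c j * (s j a i - σ j i)) hσ (W := 2 * W) (by positivity)
  rw [show 4 * (2 * W) = 8 * W by ring] at h
  refine le_trans (setLIntegral_mono' (measurableSet_cornerCube c ℓ) fun x hx => ?_)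
    ((setLIntegral_le_lintegral _ _).trans h)
  refine Finset.prod_le_prod' fun j _ => ENNReal.rpow_le_rpow ?_ hp
  refine Finset.sum_le_sum fun a ha => ?_
  refine indicator_one_le_indicator_one fun h i hi => ?_
  have hxj : |x j - c j| ≤ ℓ := by
    have := hx j (Set.mem_univ j)
    rw [abs_le]
    constructor <;> linarith [this.1, this.2]
  have hslope : |(x j - c j) * (s j a i - σ j i)| ≤ W := by
    rw [abs_mul]
    refine (mul_le_mul hxj (hs j a ha i) (abs_nonneg _) hℓ).trans ?_
    linarith
  have e : x i - (q j a i + c j * (s j a i - σ j i)) - x j * σ j i =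
      (x i - q j a i - x j * s j a i) + (x j - c j) * (s j a i - σ j i) := by ring
  change |x i - (q j a i + c j * (s j a i - σ j i)) - x j * σ j i| ≤ 2 * W
  rw [e]
  exact (abs_add_le _ _).trans (by linarith [h i hi])

theorem cornerCube_subset_slopeTube {j : Fin n} {q s c x : Fin n → ℝ} {W ℓ : ℝ} (hW : W ≤ ℓ)
    (hs : ∀ i, |s i| ≤ 1) (hx : x ∈ cornerCube c ℓ) (hxt : x ∈ slopeTube j q s W) :
    cornerCube c ℓ ⊆ slopeTube j q s (3 * ℓ) := by
  intro y hy i hi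
  have hd : ∀ k, |y k - x k| ≤ ℓ := fun k => by
    have h1 := hx k (Set.mem_univ k)
    have h2 := hy k (Set.mem_univ k)
    rw [abs_le]
    constructor <;> linarith [h1.1, h1.2, h2.1, h2.2]
  have hslope : |(y j - x j) * s i| ≤ ℓ := by
    rw [abs_mul]
    exact (mul_le_of_le_one_right (abs_nonneg _) (hs i)).trans (hd j)
  have e : y i - q i - y j * s i =
      (x i - q i - x j * s i) + (y i - x i) - (y j - x j) * s i := by ring
  rw [e]
  refine (abs_sub _ _).trans ?_
  linarith [abs_add_le (x i - q i - x j * s i) (y i - x i), hd i, hxt i hi]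

theorem setLIntegral_prod_tubeCount_le_pow {p : ℝ} (hp : 0 ≤ p) (hpn : ((n : ℝ) - 1) * p = 1)
    {ι : Fin n → Type*} (q s : ∀ j, ι j → Fin n → ℝ) {σ : Fin n → Fin n → ℝ}
    (hσ : ∀ j i, |σ j i| ≤ 1 / (2 * n)) {D : ℕ} (hD : 0 < D) {w : ℝ} (hw : 0 < w) (m : ℕ)
    (S : ∀ j, Finset (ι j)) (hs1 : ∀ j, ∀ a ∈ S j, ∀ i, |s j a i| ≤ 1)
    (hs : ∀ j, ∀ a ∈ S j, ∀ i, |s j a i - σ j i| ≤ 3 / D) (c : Fin n → ℝ) :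
    ∫⁻ x in cornerCube c (w * D ^ m), ∏ j, tubeCount j (S j) (q j) (s j) w x ^ p ≤
      ENNReal.ofReal w ^ n * (n.factorial * 24 ^ n) ^ m * ∏ j, ((S j).card : ENNReal) ^ p := by
  classical
  induction m generalizing S c with
  | zero =>
    calc _ ≤ ∫⁻ x in cornerCube c (w * D ^ 0), ∏ j, ((S j).card : ENNReal) ^ p :=
          lintegral_mono fun x => Finset.prod_le_prod' fun j _ =>
            ENNReal.rpow_le_rpow (tubeCount_le_card ..) hp
      _ = _ := by
          rw [setLIntegral_const, volume_cornerCube, pow_zero, mul_one, pow_zero, mul_one, mul_comm]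
  | succ m ih =>
    have hD' : (0 : ℝ) < D := by exact_mod_cast hD
    set ℓ : ℝ := w * D ^ m with hℓ
    have hℓ0 : 0 < ℓ := by positivity
    have hwℓ : w ≤ ℓ := le_mul_of_one_le_right hw.le (one_le_pow₀ (by exact_mod_cast hD))
    rw [show w * (D : ℝ) ^ (m + 1) = D * ℓ by rw [hℓ]; ring, lintegral_cornerCube_eq_sum D c hℓ0]
    set Q : (Fin n → Fin D) → Set (Fin n → ℝ) :=
      fun k => cornerCube (fun i => c i + (k i : ℕ) * ℓ) ℓ with hQ
    set T : (Fin n → Fin D) → ∀ j, Finset (ι j) := fun k j =>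
      (S j).filter fun a => (Q k ∩ slopeTube j (q j a) (s j a) w).Nonempty with hT
    have hsmall : ∀ k, ∫⁻ x in Q k, ∏ j, tubeCount j (S j) (q j) (s j) w x ^ p ≤
        ENNReal.ofReal w ^ n * (n.factorial * 24 ^ n) ^ m *
          ∏ j, ((T k j).card : ENNReal) ^ p := by
      intro k
      refine le_trans (setLIntegral_mono' (measurableSet_cornerCube _ _) fun x hx => ?_)
        (ih (T k) (fun j a ha => hs1 j a (Finset.mem_of_mem_filter a ha))
          (fun j a ha => hs j a (Finset.mem_of_mem_filter a ha)) fun i => c i + (k i : ℕ) * ℓ)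
      refine Finset.prod_le_prod' fun j _ => ENNReal.rpow_le_rpow (le_of_eq ?_) hp
      refine (Finset.sum_subset (Finset.filter_subset _ _) fun a ha hna => ?_).symm
      refine Set.indicator_of_notMem (fun hxa => hna ?_) _
      exact Finset.mem_filter.2 ⟨ha, x, hx, hxa⟩
    have hlarge : ∀ k, ENNReal.ofReal ℓ ^ n * ∏ j, ((T k j).card : ENNReal) ^ p ≤
        ∫⁻ x in Q k, ∏ j, tubeCount j (S j) (q j) (s j) (3 * ℓ) x ^ p := by
      intro k
      rw [← volume_cornerCube (fun i => c i + (k i : ℕ) * ℓ) ℓ, mul_comm, ← setLIntegral_const]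
      refine setLIntegral_mono' (measurableSet_cornerCube _ _) fun y hy => ?_
      refine Finset.prod_le_prod' fun j _ => ENNReal.rpow_le_rpow ?_ hp
      rw [Finset.card_eq_sum_ones, Nat.cast_sum, Nat.cast_one]
      refine le_trans (Finset.sum_le_sum fun a ha => ?_)
        (Finset.sum_le_sum_of_subset (Finset.filter_subset _ _))
      obtain ⟨haS, x, hx, hxa⟩ := Finset.mem_filter.1 ha
      rw [Set.indicator_of_mem (cornerCube_subset_slopeTube hwℓ (hs1 j a haS) hx hxa hy)]
      rfl
    have hsum : ∑ k, ∏ j, ((T k j).card : ENNReal) ^ p ≤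
        n.factorial * 24 ^ n * ∏ j, ((S j).card : ENNReal) ^ p := by
      have h0 : ENNReal.ofReal ℓ ^ n ≠ 0 := pow_ne_zero _ (ENNReal.ofReal_pos.2 hℓ0).ne'
      have htop : ENNReal.ofReal ℓ ^ n ≠ ⊤ := ENNReal.pow_ne_top ENNReal.ofReal_ne_top
      rw [← ENNReal.mul_le_mul_iff_right h0 htop, Finset.mul_sum]
      refine (Finset.sum_le_sum fun k _ => hlarge k).trans ?_
      rw [← lintegral_cornerCube_eq_sum D c hℓ0]
      refine (setLIntegral_prod_tubeCount_le_of_slopes_near hp hpn S q s hσ hs (by positivity)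
        (by positivity) (le_of_eq (by field_simp)) c).trans (le_of_eq ?_)
      rw [show 8 * (3 * ℓ) = 24 * ℓ by ring, ENNReal.ofReal_mul (by norm_num), mul_pow,
        ENNReal.ofReal_ofNat]
      ring
    calc _ ≤ ∑ k, ENNReal.ofReal w ^ n * (n.factorial * 24 ^ n) ^ m *
          ∏ j, ((T k j).card : ENNReal) ^ p := Finset.sum_le_sum fun k _ => hsmall k
      _ ≤ ENNReal.ofReal w ^ n * (n.factorial * 24 ^ n) ^ m *
          (n.factorial * 24 ^ n * ∏ j, ((S j).card : ENNReal) ^ p) := by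
          rw [← Finset.mul_sum]
          gcongr
      _ = _ := by ring

theorem ENNReal.rpow_sum_le_sum_rpow_of_le_one {α : Type*} {p : ℝ} (hp : 0 < p) (hp1 : p ≤ 1)
    (t : Finset α) (f : α → ENNReal) : (∑ i ∈ t, f i) ^ p ≤ ∑ i ∈ t, f i ^ p :=
  Finset.le_sum_of_subadditive (fun x : ENNReal => x ^ p) (ENNReal.zero_rpow_of_pos hp).le
    (fun x y => ENNReal.rpow_add_le_add_rpow x y hp.le hp1) t f

theorem exists_setLIntegral_prod_tubeCount_le_pow (n : ℕ) {p : ℝ} (hp : 0 < p) (hp1 : p ≤ 1)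
    (hpn : ((n : ℝ) - 1) * p = 1) {D : ℕ} (hD : 0 < D) {w : ℝ} (hw : 0 < w) :
    ∃ N : ℕ, ∀ {ι : Fin n → Type} (S : ∀ j, Finset (ι j)) (q s : ∀ j, ι j → Fin n → ℝ),
      (∀ j a i, |s j a i| ≤ 1 / (2 * n)) → ∀ (m : ℕ) (c : Fin n → ℝ),
      ∫⁻ x in cornerCube c (w * D ^ m), ∏ j, tubeCount j (S j) (q j) (s j) w x ^ p ≤
        N * (ENNReal.ofReal w ^ n * (n.factorial * 24 ^ n) ^ m *
          ∏ j, ((S j).card : ENNReal) ^ p) := by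
  classical
  have hD' : (0 : ℝ) < D := by exact_mod_cast hD
  have hr : (0 : ℝ) ≤ 1 / (2 * n) := by positivity
  have hr1 : 1 / (2 * n : ℝ) ≤ 1 := by
    rcases n.eq_zero_or_pos with rfl | h
    · simp
    · have : (1 : ℝ) ≤ n := by exact_mod_cast h
      rw [div_le_one (by positivity)]
      linarith
  obtain ⟨t, ht, htf, hcover⟩ := finite_cover_balls_of_compact
    (isCompact_closedBall (0 : Fin n → ℝ) (1 / (2 * n))) (div_pos three_pos hD')
  lift t to Finset (Fin n → ℝ) using htf
  refine ⟨t.card ^ n, fun {ι} S q s hs m c => ?_⟩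
  have hcap : ∀ j a, ∃ τ ∈ t, ‖s j a - τ‖ ≤ 3 / D := by
    intro j a
    have : s j a ∈ Metric.closedBall (0 : Fin n → ℝ) (1 / (2 * n)) := by
      rw [mem_closedBall_zero_iff]
      exact (pi_norm_le_iff_of_nonneg hr).2 (hs j a)
    obtain ⟨τ, hτ, hd⟩ := Set.mem_iUnion₂.1 (hcover this)
    exact ⟨τ, hτ, by rw [← dist_eq_norm]; exact (Metric.mem_ball.1 hd).le⟩
  choose cap hcapt hcapd using hcap
  have hpoint : ∀ x, ∏ j, tubeCount j (S j) (q j) (s j) w x ^ p ≤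
      ∑ σ ∈ Fintype.piFinset fun _ : Fin n => t,
        ∏ j, tubeCount j ((S j).filter fun a => cap j a = σ j) (q j) (s j) w x ^ p := by
    intro x
    rw [← Finset.prod_univ_sum (fun _ => t) fun j τ =>
      tubeCount j ((S j).filter fun a => cap j a = τ) (q j) (s j) w x ^ p]
    refine Finset.prod_le_prod' fun j _ => ?_
    refine le_trans (le_of_eq ?_) (ENNReal.rpow_sum_le_sum_rpow_of_le_one hp hp1 t _)
    congr 1
    exact (Finset.sum_fiberwise_of_maps_to (fun a _ => hcapt j a) _).symm
  refine (lintegral_mono hpoint).trans ?_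
  rw [lintegral_finsetSum _ fun σ _ =>
    Finset.measurable_fun_prod _ fun j _ => (measurable_tubeCount ..).pow_const p]
  refine (Finset.sum_le_card_nsmul _ _ (ENNReal.ofReal w ^ n * (n.factorial * 24 ^ n) ^ m *
    ∏ j, ((S j).card : ENNReal) ^ p) fun σ hσ => ?_).trans (le_of_eq ?_)
  · have hσt : ∀ j, σ j ∈ t := Fintype.mem_piFinset.1 hσ
    refine (setLIntegral_prod_tubeCount_le_pow hp.le hpn q s (σ := σ) ?_ hD hw m _
      (fun j a _ i => (hs j a i).trans hr1) ?_ c).trans ?_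
    · intro j i
      exact (norm_le_pi_norm (σ j) i).trans (mem_closedBall_zero_iff.1 (ht (hσt j)))
    · intro j a ha i
      rw [← (Finset.mem_filter.1 ha).2]
      exact (norm_le_pi_norm (s j a - cap j a) i).trans (hcapd j a)
    · refine mul_le_mul' le_rfl (Finset.prod_le_prod' fun j _ => ENNReal.rpow_le_rpow ?_ hp.le)
      exact_mod_cast Finset.card_le_card (Finset.filter_subset _ _)
  · simp [Fintype.card_piFinset]

theorem half_le_apply_and_abs_apply_le_of_angle_le {j : Fin n} {v : EuclideanSpace ℝ (Fin n)}
    (hv : ‖v‖ = 1)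
    (hangle : InnerProductGeometry.angle v (EuclideanSpace.single j (1 : ℝ)) ≤ 1 / (100 * n)) :
    1 / 2 ≤ v j ∧ ∀ i, i ≠ j → |v i| ≤ 1 / (100 * n) := by
  have hn : (1 : ℝ) ≤ n := by exact_mod_cast Fin.pos j
  have hcos : v j = Real.cos (InnerProductGeometry.angle v (EuclideanSpace.single j (1 : ℝ))) := by
    rw [InnerProductGeometry.cos_angle, hv]
    simp [EuclideanSpace.inner_single_right]
  set θ : ℝ := 1 / (100 * n) with hθ
  have hθ0 : 0 < θ := by positivity
  have hθ1 : θ ≤ 1 / 100 := by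
    rw [hθ]
    exact one_div_le_one_div_of_le (by norm_num) (by linarith)
  have hsq : InnerProductGeometry.angle v (EuclideanSpace.single j (1 : ℝ)) ^ 2 ≤ θ ^ 2 :=
    pow_le_pow_left₀ (InnerProductGeometry.angle_nonneg _ _) hangle 2
  have hvj : 1 - θ ^ 2 / 2 ≤ v j := by
    rw [hcos]
    linarith [Real.one_sub_sq_div_two_le_cos
      (x := InnerProductGeometry.angle v (EuclideanSpace.single j (1 : ℝ)))]
  refine ⟨by nlinarith, fun i hi => abs_le_of_sq_le_sq ?_ hθ0.le⟩
  have hsum : v i ^ 2 + v j ^ 2 ≤ 1 := by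
    have h := EuclideanSpace.norm_sq_eq v
    rw [hv] at h
    simp only [Real.norm_eq_abs, sq_abs, one_pow] at h
    rw [h, ← Finset.sum_pair (f := fun k => v k ^ 2) hi]
    exact Finset.sum_le_univ_sum_of_nonneg fun k => sq_nonneg _
  nlinarith

/-- The slopes, relative to the `j`-th coordinate, of a line with direction `v`. -/
noncomputable def lineSlope (j : Fin n) (v : EuclideanSpace ℝ (Fin n)) (i : Fin n) : ℝ :=
  if i = j then 0 else v i / v j

theorem abs_lineSlope_le {j : Fin n} {v : EuclideanSpace ℝ (Fin n)} (hv : ‖v‖ = 1)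
    (hangle : InnerProductGeometry.angle v (EuclideanSpace.single j (1 : ℝ)) ≤ 1 / (100 * n))
    (i : Fin n) : |lineSlope j v i| ≤ 1 / (2 * n) := by
  have hn : (0 : ℝ) < n := by exact_mod_cast Fin.pos j
  obtain ⟨hj, h⟩ := half_le_apply_and_abs_apply_le_of_angle_le hv hangle
  rw [lineSlope]
  split_ifs with hi
  · simp
  · rw [abs_div, abs_of_pos (by linarith : 0 < v j), div_le_iff₀ (by linarith)]
    refine (h i hi).trans ?_
    calc 1 / (100 * n : ℝ) ≤ 1 / (2 * n) * (1 / 2) := by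
          rw [div_mul_div_comm, one_mul]
          exact one_div_le_one_div_of_le (by positivity) (by linarith)
      _ ≤ 1 / (2 * n) * v j := by gcongr

theorem mem_slopeTube_of_infDist_le {j : Fin n} {p v x : EuclideanSpace ℝ (Fin n)} (hv : ‖v‖ = 1)
    (hangle : InnerProductGeometry.angle v (EuclideanSpace.single j (1 : ℝ)) ≤ 1 / (100 * n))
    (hx : Metric.infDist x (Set.range fun t : ℝ => p + t • v) ≤ 1) :
    x.ofLp ∈ slopeTube j (fun i => p i - p j * lineSlope j v i) (lineSlope j v) 4 := by
  have hn : (1 : ℝ) ≤ n := by exact_mod_cast Fin.pos j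
  obtain ⟨_, ⟨t, rfl⟩, ht⟩ := (Metric.infDist_lt_iff (Set.range_nonempty _)).1
    (hx.trans_lt one_lt_two)
  have hcoord : ∀ k, |x k - (p k + t * v k)| ≤ 2 := fun k => by
    rw [dist_eq_norm] at ht
    simpa using (PiLp.norm_apply_le (x - (p + t • v)) k).trans ht.le
  intro i hi
  obtain ⟨hj, -⟩ := half_le_apply_and_abs_apply_le_of_angle_le hv hangle
  have hs : v i = v j * lineSlope j v i := by
    rw [lineSlope, if_neg hi, mul_div_cancel₀ _ (by linarith : v j ≠ 0)]
  have hs1 : |lineSlope j v i| ≤ 1 := by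
    refine (abs_lineSlope_le hv hangle i).trans ?_
    rw [div_le_one (by positivity)]
    linarith
  have e : x i - (p i - p j * lineSlope j v i) - x j * lineSlope j v i =
      (x i - (p i + t * v i)) - (x j - (p j + t * v j)) * lineSlope j v i := by
    rw [hs]; ring
  rw [e]
  refine (abs_sub _ _).trans ?_
  rw [abs_mul]
  linarith [hcoord i, (mul_le_of_le_one_right (abs_nonneg _) hs1).trans (hcoord j)]

end

/-- Multilinear Kakeya (Bennett–Carbery–Tao): if for each `j ∈ {1,…,n}` the lines
`ℓ_{j,a} = {p_{j,a} + t v_{j,a}}`, `a = 1,…,A_j`, make angle at most `1/(100n)` with the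
`x_j`-axis, and `T_{j,a}` is the characteristic function of the unit neighborhood of `ℓ_{j,a}`,
then for every cube `B_R` of side length `R ≥ 1`,
`∫_{B_R} ∏_j (∑_a T_{j,a})^{1/(n-1)} ≤ C(n,ε) R^ε ∏_j A_j^{1/(n-1)}`. -/
theorem multilinear_kakeya (n : ℕ) (hn : 2 ≤ n) (ε : ℝ) (hε : 0 < ε) :
    ∃ C : ℝ, ∀ A : Fin n → ℕ,
      ∀ p : (j : Fin n) → Fin (A j) → EuclideanSpace ℝ (Fin n),
      ∀ v : (j : Fin n) → Fin (A j) → EuclideanSpace ℝ (Fin n),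
      (∀ j a, ‖v j a‖ = 1) →
      (∀ j a, InnerProductGeometry.angle (v j a) (EuclideanSpace.single j (1 : ℝ))
          ≤ 1 / (100 * n)) →
      ∀ R : ℝ, 1 ≤ R → ∀ c : Fin n → ℝ,
      (∫ x in {x : EuclideanSpace ℝ (Fin n) | ∀ j, x j ∈ Set.Icc (c j) (c j + R)},
          ∏ j, (∑ a, Set.indicator
              {y : EuclideanSpace ℝ (Fin n) |
                Metric.infDist y (Set.range fun t : ℝ => p j a + t • v j a) ≤ 1}
              (fun _ => (1 : ℝ)) x) ^ (1 / ((n : ℝ) - 1)))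
        ≤ C * R ^ ε * ∏ j, (A j : ℝ) ^ (1 / ((n : ℝ) - 1)) := by
  set r : ℝ := 1 / ((n : ℝ) - 1) with hr
  have hn1 : (1 : ℝ) ≤ (n : ℝ) - 1 := by
    have : (2 : ℝ) ≤ n := by exact_mod_cast hn
    linarith
  have hr0 : 0 < r := by positivity
  have hr1 : r ≤ 1 := (div_le_one (by positivity)).2 hn1
  have hrn : ((n : ℝ) - 1) * r = 1 := mul_one_div_cancel (by positivity)
  set K : ℝ := n.factorial * 24 ^ n with hK
  have hK0 : 0 < K := by positivity
  obtain ⟨D, hD2, hDK⟩ : ∃ D : ℕ, 2 ≤ D ∧ K ≤ (D : ℝ) ^ ε :=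
    ((Filter.eventually_ge_atTop 2).and (((tendsto_rpow_atTop hε).comp
      tendsto_natCast_atTop_atTop).eventually_ge_atTop K)).exists
  obtain ⟨N, hN⟩ := exists_setLIntegral_prod_tubeCount_le_pow n hr0 hr1 hrn
    (by omega : 0 < D) (four_pos (α := ℝ))
  refine ⟨N * 4 ^ n * K, fun A p v hv hangle R hR c => ?_⟩
  obtain ⟨m, hm, hmR⟩ := exists_nat_pow_near hR (by exact_mod_cast hD2 : (1 : ℝ) < D)
  have hbound := hN (fun j => (Finset.univ : Finset (Fin (A j))))
    (fun j a i => p j a i - p j a j * lineSlope j (v j a) i) (fun j a => lineSlope j (v j a))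
    (fun j a => abs_lineSlope_le (hv j a) (hangle j a)) (m + 1) c
  set P : ℝ := ∏ j, (A j : ℝ) ^ r with hP
  have hP0 : 0 ≤ P := by positivity
  have hB : (N : ENNReal) * (ENNReal.ofReal 4 ^ n * (n.factorial * 24 ^ n) ^ (m + 1) *
      ∏ j, (((Finset.univ : Finset (Fin (A j))).card : ℕ) : ENNReal) ^ r) =
      ENNReal.ofReal (N * (4 ^ n * K ^ (m + 1) * P)) := by
    rw [ENNReal.ofReal_mul (by positivity), ENNReal.ofReal_mul (by positivity),
      ENNReal.ofReal_mul (by positivity), ENNReal.ofReal_pow (by positivity),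
      ENNReal.ofReal_pow (by positivity), hK, ENNReal.ofReal_mul (by positivity),
      ENNReal.ofReal_pow (by positivity), hP,
      ENNReal.ofReal_prod_of_nonneg fun _ _ => by positivity]
    simp [← ENNReal.ofReal_rpow_of_nonneg, hr0.le]
  have hint : ∀ x : EuclideanSpace ℝ (Fin n), ENNReal.ofReal ‖∏ j, (∑ a, Set.indicator
      {y : EuclideanSpace ℝ (Fin n) |
        Metric.infDist y (Set.range fun t : ℝ => p j a + t • v j a) ≤ 1}
      (fun _ => (1 : ℝ)) x) ^ r‖ ≤
      ∏ j, tubeCount j Finset.univ (fun a i => p j a i - p j a j * lineSlope j (v j a) i)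
        (fun a => lineSlope j (v j a)) 4 x.ofLp ^ r := by
    intro x
    have hnn : ∀ j a, 0 ≤ Set.indicator {y : EuclideanSpace ℝ (Fin n) |
        Metric.infDist y (Set.range fun t : ℝ => p j a + t • v j a) ≤ 1} (fun _ => (1 : ℝ)) x :=
      fun j a => Set.indicator_nonneg (fun _ _ => zero_le_one) x
    have hnn' := fun j => Finset.sum_nonneg fun a (_ : a ∈ Finset.univ) => hnn j a
    rw [Real.norm_of_nonneg (Finset.prod_nonneg fun j _ => Real.rpow_nonneg (hnn' j) r),
      ENNReal.ofReal_prod_of_nonneg fun j _ => Real.rpow_nonneg (hnn' j) r]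
    refine Finset.prod_le_prod' fun j _ => ?_
    rw [← ENNReal.ofReal_rpow_of_nonneg (hnn' j) hr0.le,
      ENNReal.ofReal_sum_of_nonneg fun a _ => hnn j a]
    refine ENNReal.rpow_le_rpow (Finset.sum_le_sum fun a _ => ?_) hr0.le
    by_cases hx : x ∈ {y : EuclideanSpace ℝ (Fin n) |
        Metric.infDist y (Set.range fun t : ℝ => p j a + t • v j a) ≤ 1}
    · rw [Set.indicator_of_mem hx, ENNReal.ofReal_one,
        Set.indicator_of_mem (mem_slopeTube_of_infDist_le (hv j a) (hangle j a) hx), Pi.one_apply]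
    · rw [Set.indicator_of_notMem hx, ENNReal.ofReal_zero]
      exact zero_le
  have hcube : {x : EuclideanSpace ℝ (Fin n) | ∀ j, x j ∈ Set.Icc (c j) (c j + R)} ⊆
      WithLp.ofLp ⁻¹' cornerCube c (4 * D ^ (m + 1)) := by
    intro x hx j _
    exact ⟨(hx j).1, by linarith [(hx j).2]⟩
  refine (Real.le_norm_self _).trans ((norm_integral_le_lintegral_norm _).trans ?_)
  refine ENNReal.toReal_le_of_le_ofReal (by positivity) ?_
  calc _ ≤ ∫⁻ x in WithLp.ofLp ⁻¹' cornerCube c (4 * D ^ (m + 1)),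
        ∏ j, tubeCount j Finset.univ (fun a i => p j a i - p j a j * lineSlope j (v j a) i)
          (fun a => lineSlope j (v j a)) 4 (WithLp.ofLp x) ^ r :=
        (lintegral_mono hint).trans (lintegral_mono_set hcube)
    _ = ∫⁻ x in cornerCube c (4 * D ^ (m + 1)),
        ∏ j, tubeCount j Finset.univ (fun a i => p j a i - p j a j * lineSlope j (v j a) i)
          (fun a => lineSlope j (v j a)) 4 x ^ r :=
        (PiLp.volume_preserving_ofLp (Fin n)).setLIntegral_comp_preimage_emb
          (MeasurableEquiv.toLp 2 (Fin n → ℝ)).symm.measurableEmbedding (fun x => ∏ j,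
            tubeCount j Finset.univ (fun a i => p j a i - p j a j * lineSlope j (v j a) i)
              (fun a => lineSlope j (v j a)) 4 x ^ r) _
    _ ≤ ENNReal.ofReal (N * (4 ^ n * K ^ (m + 1) * P)) := hbound.trans_eq hB
    _ ≤ _ := by
        refine ENNReal.ofReal_le_ofReal ?_
        have hKR : K ^ m ≤ R ^ ε :=
          calc K ^ m ≤ ((D : ℝ) ^ ε) ^ m := pow_le_pow_left₀ hK0.le hDK m
            _ = ((D : ℝ) ^ m) ^ ε := Real.rpow_pow_comm (by positivity) _ _
            _ ≤ R ^ ε := Real.rpow_le_rpow (by positivity) hm hε.le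
        calc N * (4 ^ n * K ^ (m + 1) * P) = N * 4 ^ n * K * K ^ m * P := by ring
          _ ≤ N * 4 ^ n * K * R ^ ε * P := by gcongr
end

section
/- (Fefferman's restriction theorem in the plane.) Let a : [−1,1] → ℂ be measurable with |a(ξ)| ≤ 1 for all ξ, and define f : ℝ² → ℂ by f(x₁, x₂) = ∫_{−1}^{1} a(ξ) e^{2πi( x₁ ξ + x₂ ξ² )} dξ. Then for every p > 4 there is a constant C(p), independent of a, such that ‖f‖_{L^p(ℝ²)} ≤ C(p). -/
open MeasureTheory

namespace ParabolaRestriction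

open Complex Filter Topology
open scoped ENNReal Real

/-- The character `w ↦ e^{2πi x·w}` of the plane. -/
noncomputable def planeChar (x w : ℝ × ℝ) : ℂ :=
  cexp (2 * π * I * ((x.1 * w.1 + x.2 * w.2 : ℝ) : ℂ))

@[simp]
lemma norm_planeChar (x w : ℝ × ℝ) : ‖planeChar x w‖ = 1 := by
  rw [planeChar, show 2 * (π : ℂ) * I * ((x.1 * w.1 + x.2 * w.2 : ℝ) : ℂ) =
    ((2 * π * (x.1 * w.1 + x.2 * w.2) : ℝ) : ℂ) * I by push_cast; ring]
  exact norm_exp_ofReal_mul_I _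

lemma planeChar_add (x w w' : ℝ × ℝ) :
    planeChar x (w + w') = planeChar x w * planeChar x w' := by
  simp only [planeChar, ← Complex.exp_add, Prod.fst_add, Prod.snd_add]
  congr 1
  push_cast
  ring

lemma planeChar_sub (x w w' : ℝ × ℝ) :
    planeChar x (w - w') = planeChar x w * (starRingEnd ℂ) (planeChar x w') := by
  simp only [planeChar, ← Complex.exp_add, ← Complex.exp_conj, Prod.fst_sub, Prod.snd_sub,
    map_mul, conj_I, conj_ofReal, map_ofNat]
  congr 1
  push_cast
  ring

lemma continuous_planeChar : Continuous fun q : (ℝ × ℝ) × (ℝ × ℝ) ↦ planeChar q.1 q.2 := by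
  unfold planeChar
  fun_prop

/-- The isotropic Gaussian `e^{-b|x|²}` on the plane. -/
noncomputable def planeGaussian (b : ℝ) (x : ℝ × ℝ) : ℝ :=
  Real.exp (-b * x.1 ^ 2) * Real.exp (-b * x.2 ^ 2)

/-- The Fourier transform of `planeGaussian b`. -/
noncomputable def planeGaussianFourier (b : ℝ) (w : ℝ × ℝ) : ℝ :=
  π / b * planeGaussian (π ^ 2 / b) w

lemma planeGaussian_nonneg (b : ℝ) (x : ℝ × ℝ) : 0 ≤ planeGaussian b x := by
  unfold planeGaussian
  positivity

lemma planeGaussianFourier_nonneg {b : ℝ} (hb : 0 < b) (x : ℝ × ℝ) :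
    0 ≤ planeGaussianFourier b x := by
  have := planeGaussian_nonneg (π ^ 2 / b) x
  unfold planeGaussianFourier
  positivity

lemma continuous_planeGaussian (b : ℝ) : Continuous (planeGaussian b) := by
  unfold planeGaussian
  fun_prop

lemma continuous_planeGaussianFourier (b : ℝ) : Continuous (planeGaussianFourier b) :=
  continuous_const.mul (continuous_planeGaussian _)

lemma integrable_planeGaussian {b : ℝ} (hb : 0 < b) : Integrable (planeGaussian b) :=
  (integrable_exp_neg_mul_sq hb).mul_prod (integrable_exp_neg_mul_sq hb)

lemma integral_planeGaussian {b : ℝ} (hb : 0 < b) : ∫ x, planeGaussian b x = π / b := by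
  unfold planeGaussian
  rw [Measure.volume_eq_prod,
    integral_prod_mul (fun t : ℝ ↦ Real.exp (-b * t ^ 2)) (fun t : ℝ ↦ Real.exp (-b * t ^ 2)),
    integral_gaussian, Real.mul_self_sqrt (by positivity)]

lemma lintegral_planeGaussianFourier {b : ℝ} (hb : 0 < b) :
    ∫⁻ w, ENNReal.ofReal (planeGaussianFourier b w) = 1 := by
  have hc : 0 < π ^ 2 / b := by positivity
  rw [← ofReal_integral_eq_lintegral_ofReal]
  · unfold planeGaussianFourier
    rw [integral_const_mul, integral_planeGaussian hc]
    have : π / b * (π / (π ^ 2 / b)) = 1 := by field_simp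
    simp [this]
  · exact (integrable_planeGaussian hc).const_mul _
  · exact Eventually.of_forall (planeGaussianFourier_nonneg hb)

lemma integral_planeChar_mul_planeGaussian {b : ℝ} (hb : 0 < b) (w : ℝ × ℝ) :
    ∫ x, planeChar x w * (planeGaussian b x : ℂ) = (planeGaussianFourier b w : ℂ) := by
  have one_dim (t : ℝ) : ∫ s : ℝ, cexp (I * ((2 * π * t : ℝ) : ℂ) * s) * cexp (-b * s ^ 2) =
      (π / b : ℂ) ^ (1 / 2 : ℂ) * cexp (-(π ^ 2 / b) * t ^ 2) := by
    rw [fourierIntegral_gaussian (by simpa using hb)]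
    congr 2
    have : (b : ℂ) ≠ 0 := by exact_mod_cast hb.ne'
    push_cast
    field_simp
    ring
  let φ (t s : ℝ) : ℂ := cexp (I * ((2 * π * t : ℝ) : ℂ) * s) * cexp (-b * s ^ 2)
  have split (x : ℝ × ℝ) : planeChar x w * (planeGaussian b x : ℂ) = φ w.1 x.1 * φ w.2 x.2 := by
    simp only [planeChar, planeGaussian, φ]
    push_cast
    simp only [← Complex.exp_add]
    congr 1
    ring
  simp_rw [split]
  rw [Measure.volume_eq_prod, integral_prod_mul, one_dim w.1, one_dim w.2]
  have hsq : (π / b : ℂ) ^ (1 / 2 : ℂ) * (π / b : ℂ) ^ (1 / 2 : ℂ) = π / b := by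
    have : (π / b : ℂ) ≠ 0 := by
      have : (b : ℂ) ≠ 0 := by exact_mod_cast hb.ne'
      have : (π : ℂ) ≠ 0 := by exact_mod_cast Real.pi_ne_zero
      positivity
    rw [← Complex.cpow_add _ _ this]
    norm_num
  simp only [planeGaussianFourier, planeGaussian]
  push_cast
  linear_combination (cexp (-(π ^ 2 / b) * w.1 ^ 2) * cexp (-(π ^ 2 / b) * w.2 ^ 2)) * hsq

section Oscillatory

variable {α : Type*} [MeasurableSpace α] {μ : Measure α} {Φ : α → ℝ × ℝ} {h : α → ℂ}

/-- The Fourier transform of the image under `Φ` of the complex measure `h μ`. -/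
noncomputable def oscInt (μ : Measure α) (Φ : α → ℝ × ℝ) (h : α → ℂ) (x : ℝ × ℝ) : ℂ :=
  ∫ z, h z * planeChar x (Φ z) ∂μ

lemma measurable_planeChar_comp (hΦ : Measurable Φ) :
    Measurable fun q : (ℝ × ℝ) × α ↦ planeChar q.1 (Φ q.2) :=
  continuous_planeChar.measurable.comp
    (measurable_fst.prodMk (hΦ.comp measurable_snd))

lemma stronglyMeasurable_oscInt [SFinite μ] (hΦ : Measurable Φ) (hh : Measurable h) :
    StronglyMeasurable (oscInt μ Φ h) :=
  StronglyMeasurable.integral_prod_right'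
    (f := fun q : (ℝ × ℝ) × α ↦ h q.2 * planeChar q.1 (Φ q.2))
    ((hh.comp measurable_snd).mul (measurable_planeChar_comp hΦ)).stronglyMeasurable

lemma norm_oscInt_le [IsFiniteMeasure μ] (hb : ∀ z, ‖h z‖ ≤ 1) (x : ℝ × ℝ) :
    ‖oscInt μ Φ h x‖ ≤ μ.real Set.univ := by
  simpa [oscInt] using norm_integral_le_of_norm_le_const (μ := μ) (C := 1)
    (f := fun z ↦ h z * planeChar x (Φ z)) (Eventually.of_forall fun z ↦ by simpa using hb z)

lemma integral_planeGaussian_mul_normSq_oscInt [IsFiniteMeasure μ] (hΦ : Measurable Φ)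
    (hh : Measurable h) (hb : ∀ z, ‖h z‖ ≤ 1) {b : ℝ} (hb0 : 0 < b) :
    ∫ x, ((planeGaussian b x * ‖oscInt μ Φ h x‖ ^ 2 : ℝ) : ℂ) =
      ∫ q : α × α, h q.1 * (starRingEnd ℂ) (h q.2) *
        (planeGaussianFourier b (Φ q.1 - Φ q.2) : ℂ) ∂(μ.prod μ) := by
  have expand (x : ℝ × ℝ) : ((planeGaussian b x * ‖oscInt μ Φ h x‖ ^ 2 : ℝ) : ℂ) =
      ∫ q : α × α, h q.1 * (starRingEnd ℂ) (h q.2) *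
        (planeChar x (Φ q.1 - Φ q.2) * planeGaussian b x) ∂(μ.prod μ) := by
    push_cast
    rw [← Complex.mul_conj', oscInt, ← integral_conj, ← integral_prod_mul, ← integral_const_mul]
    congr 1 with q
    rw [planeChar_sub, map_mul]
    ring
  simp_rw [expand]
  rw [integral_integral_swap]
  · simp_rw [integral_const_mul, integral_planeChar_mul_planeGaussian hb0]
  · have hg : Integrable (fun q : (ℝ × ℝ) × (α × α) ↦ planeGaussian b q.1)
        ((volume : Measure (ℝ × ℝ)).prod (μ.prod μ)) :=
      (integrable_planeGaussian hb0).comp_fst _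
    refine hg.mono' (Measurable.aestronglyMeasurable ?_) (Eventually.of_forall fun q ↦ ?_)
    · have h1 : Measurable fun q : (ℝ × ℝ) × (α × α) ↦ planeChar q.1 (Φ q.2.1 - Φ q.2.2) :=
        measurable_planeChar_comp (Φ := fun q : α × α ↦ Φ q.1 - Φ q.2)
          ((hΦ.comp measurable_fst).sub (hΦ.comp measurable_snd))
      have h2 : Measurable fun q : (ℝ × ℝ) × (α × α) ↦ (planeGaussian b q.1 : ℂ) :=
        Complex.measurable_ofReal.comp
          ((continuous_planeGaussian b).measurable.comp measurable_fst)
      have h3 : Measurable fun z ↦ (starRingEnd ℂ) (h z) :=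
        Complex.continuous_conj.measurable.comp hh
      exact (((hh.comp (measurable_fst.comp measurable_snd))).mul
        (h3.comp (measurable_snd.comp measurable_snd))).mul (h1.mul h2)
    · simp only [Function.uncurry, norm_mul, norm_planeChar, RCLike.norm_conj, one_mul,
        Complex.norm_real, Real.norm_of_nonneg (planeGaussian_nonneg b q.1)]
      exact mul_le_of_le_one_left (planeGaussian_nonneg _ _)
        (mul_le_one₀ (hb _) (norm_nonneg _) (hb _))

lemma lintegral_planeGaussian_mul_oscInt_sq_le [IsFiniteMeasure μ] (hΦ : Measurable Φ)
    (hh : Measurable h) (hb : ∀ z, ‖h z‖ ≤ 1) {M : ℝ≥0∞} {b : ℝ} (hb0 : 0 < b)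
    (hM : ∀ w, ∫⁻ z, ENNReal.ofReal (planeGaussianFourier b (w - Φ z)) ∂μ ≤ M) :
    ∫⁻ x, ENNReal.ofReal (planeGaussian b x * ‖oscInt μ Φ h x‖ ^ 2) ≤ M * μ Set.univ := by
  have hnn (x : ℝ × ℝ) : 0 ≤ planeGaussian b x * ‖oscInt μ Φ h x‖ ^ 2 :=
    mul_nonneg (planeGaussian_nonneg _ _) (sq_nonneg _)
  have hint : Integrable fun x ↦ planeGaussian b x * ‖oscInt μ Φ h x‖ ^ 2 := by
    refine (integrable_planeGaussian hb0).mul_bdd (c := μ.real Set.univ ^ 2)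
      ((stronglyMeasurable_oscInt hΦ hh).norm.pow 2).aestronglyMeasurable
      (Eventually.of_forall fun x ↦ ?_)
    rw [norm_pow, norm_norm]
    gcongr
    exact norm_oscInt_le hb x
  rw [← ofReal_integral_eq_lintegral_ofReal hint (Eventually.of_forall hnn),
    ← Real.norm_of_nonneg (integral_nonneg hnn), ← Complex.norm_real, ofReal_norm,
    ← integral_complex_ofReal, integral_planeGaussian_mul_normSq_oscInt hΦ hh hb hb0]
  have hmeas : Measurable fun q : α × α ↦
      ENNReal.ofReal (planeGaussianFourier b (Φ q.1 - Φ q.2)) :=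
    ENNReal.measurable_ofReal.comp ((continuous_planeGaussianFourier b).measurable.comp
      ((hΦ.comp measurable_fst).sub (hΦ.comp measurable_snd)))
  calc _ ≤ _ := enorm_integral_le_lintegral_enorm _
    _ ≤ ∫⁻ q : α × α, ENNReal.ofReal (planeGaussianFourier b (Φ q.1 - Φ q.2)) ∂(μ.prod μ) := by
      refine lintegral_mono fun q ↦ ?_
      rw [← ofReal_norm]
      refine ENNReal.ofReal_le_ofReal ?_
      rw [norm_mul, norm_mul, RCLike.norm_conj, Complex.norm_real,
        Real.norm_of_nonneg (planeGaussianFourier_nonneg hb0 _)]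
      exact mul_le_of_le_one_left (planeGaussianFourier_nonneg hb0 _)
        (mul_le_one₀ (hb _) (norm_nonneg _) (hb _))
    _ = ∫⁻ z, ∫⁻ z', ENNReal.ofReal (planeGaussianFourier b (Φ z - Φ z')) ∂μ ∂μ :=
      lintegral_prod _ hmeas.aemeasurable
    _ ≤ ∫⁻ _, M ∂μ := lintegral_mono fun z ↦ hM _
    _ = M * μ Set.univ := lintegral_const _

/-- An `L²` bound for oscillatory integrals by testing against Gaussians of all scales. -/
lemma lintegral_oscInt_sq_le [IsFiniteMeasure μ] (hΦ : Measurable Φ)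
    (hh : Measurable h) (hb : ∀ z, ‖h z‖ ≤ 1) {M : ℝ≥0∞}
    (hM : ∀ b, 0 < b → ∀ w,
      ∫⁻ z, ENNReal.ofReal (planeGaussianFourier b (w - Φ z)) ∂μ ≤ M) :
    ∫⁻ x, ENNReal.ofReal (‖oscInt μ Φ h x‖ ^ 2) ≤ M * μ Set.univ := by
  have hlim (x : ℝ × ℝ) : Tendsto (fun n : ℕ ↦
      ENNReal.ofReal (planeGaussian (1 / ((n : ℝ) + 1)) x * ‖oscInt μ Φ h x‖ ^ 2)) atTop
      (𝓝 (ENNReal.ofReal (‖oscInt μ Φ h x‖ ^ 2))) := by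
    refine ENNReal.tendsto_ofReal ?_
    have hc : Continuous fun b : ℝ ↦ planeGaussian b x * ‖oscInt μ Φ h x‖ ^ 2 := by
      unfold planeGaussian
      fun_prop
    have := (hc.tendsto 0).comp (tendsto_one_div_add_atTop_nhds_zero_nat (𝕜 := ℝ))
    simpa [planeGaussian, Function.comp_def] using this
  simp_rw [← fun x ↦ (hlim x).liminf_eq]
  refine (lintegral_liminf_le fun n ↦ ?_).trans ?_
  · exact ENNReal.measurable_ofReal.comp ((continuous_planeGaussian _).measurable.mul
      ((stronglyMeasurable_oscInt hΦ hh).norm.measurable.pow_const 2))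
  · refine liminf_le_of_le ?_ fun c hc ↦ ?_
    · isBoundedDefault
    · obtain ⟨n, hn⟩ := hc.exists
      have hn0 : 0 < 1 / ((n : ℝ) + 1) := by positivity
      exact hn.trans (lintegral_planeGaussian_mul_oscInt_sq_le hΦ hh hb hn0 (hM _ hn0))

end Oscillatory

section SumMap

/-- The sum `(ξ, ξ²) + (η, η²)` of two points of the parabola. -/
def parabolaSum (z : ℝ × ℝ) : ℝ × ℝ := (z.1 + z.2, z.1 ^ 2 + z.2 ^ 2)

lemma continuous_parabolaSum : Continuous parabolaSum := by
  unfold parabolaSum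
  fun_prop

/-- The derivative of `parabolaSum`. -/
noncomputable def fderivParabolaSum (z : ℝ × ℝ) : ℝ × ℝ →L[ℝ] ℝ × ℝ :=
  (Matrix.toLin (.finTwoProd ℝ) (.finTwoProd ℝ)
    !![1, 1; 2 * z.1, 2 * z.2]).toContinuousLinearMap

lemma hasFDerivAt_parabolaSum (z : ℝ × ℝ) :
    HasFDerivAt parabolaSum (fderivParabolaSum z) z := by
  unfold fderivParabolaSum
  rw [Matrix.toLin_finTwoProd_toContinuousLinearMap]
  have h1 : HasFDerivAt (Prod.fst : ℝ × ℝ → ℝ) (ContinuousLinearMap.fst ℝ ℝ ℝ) z := hasFDerivAt_fst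
  have h2 : HasFDerivAt (Prod.snd : ℝ × ℝ → ℝ) (ContinuousLinearMap.snd ℝ ℝ ℝ) z := hasFDerivAt_snd
  convert! (h1.add h2).prodMk ((h1.pow 2).add (h2.pow 2)) using 2 <;> simp

lemma det_fderivParabolaSum (z : ℝ × ℝ) : (fderivParabolaSum z).det = 2 * (z.2 - z.1) := by
  conv_lhs => rw [fderivParabolaSum, ContinuousLinearMap.det]
  simp only [LinearMap.coe_toContinuousLinearMap, LinearMap.det_toLin, Matrix.det_fin_two_of]
  ring

lemma parabolaSum_swap (z : ℝ × ℝ) : parabolaSum z.swap = parabolaSum z := by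
  simp [parabolaSum, add_comm]

lemma injOn_parabolaSum_lt : Set.InjOn parabolaSum {z | z.1 < z.2} := by
  rintro ⟨a, b⟩ hab ⟨c, d⟩ hcd h
  simp only [parabolaSum, Prod.mk.injEq, Set.mem_ofPred_eq] at *
  obtain ⟨h1, h2⟩ := h
  have h3 : (a - c) * (a - d) = 0 := by
    have : b = c + d - a := by linarith
    subst this
    nlinarith
  rcases mul_eq_zero.mp h3 with h | h <;> constructor <;> linarith

lemma injOn_parabolaSum_gt : Set.InjOn parabolaSum {z | z.2 < z.1} := by
  intro z hz w hw h
  rw [← parabolaSum_swap z, ← parabolaSum_swap w] at h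
  exact Prod.swap_injective (injOn_parabolaSum_lt hz hw h)

lemma setLIntegral_comp_parabolaSum_le {S : Set (ℝ × ℝ)} (hS : MeasurableSet S)
    (hinj : Set.InjOn parabolaSum S) {δ : ℝ} (hδ : 0 < δ) (hsep : ∀ z ∈ S, δ ≤ |z.1 - z.2|)
    (g : ℝ × ℝ → ℝ≥0∞) :
    ∫⁻ z in S, g (parabolaSum z) ≤ ENNReal.ofReal (1 / (2 * δ)) * ∫⁻ y, g y := by
  have hcv := lintegral_image_eq_lintegral_abs_det_fderiv_mul volume hS
    (fun z _ ↦ (hasFDerivAt_parabolaSum z).hasFDerivWithinAt) hinj g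
  calc ∫⁻ z in S, g (parabolaSum z)
      = ENNReal.ofReal (1 / (2 * δ)) *
          ∫⁻ z in S, ENNReal.ofReal (2 * δ) * g (parabolaSum z) := by
        rw [lintegral_const_mul' _ _ ENNReal.ofReal_ne_top, ← mul_assoc,
          ← ENNReal.ofReal_mul (by positivity), one_div_mul_cancel (by positivity)]
        simp
    _ ≤ ENNReal.ofReal (1 / (2 * δ)) *
          ∫⁻ z in S, ENNReal.ofReal |(fderivParabolaSum z).det| * g (parabolaSum z) := by
        refine mul_le_mul_right (α := ℝ≥0∞) ?_ _
        refine setLIntegral_mono' hS fun z hz ↦ ?_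
        gcongr
        rw [det_fderivParabolaSum, abs_mul, abs_two, abs_sub_comm]
        linarith [hsep z hz]
    _ ≤ _ := by
        rw [← hcv]
        exact mul_le_mul_right (α := ℝ≥0∞) (setLIntegral_le_lintegral _ _) _

/-- The part of the square `[-1,1]²` at distance between `δ` and `2δ` from the diagonal. -/
def diagonalShell (δ : ℝ) : Set (ℝ × ℝ) :=
  (Set.Icc (-1) 1 ×ˢ Set.Icc (-1) 1) ∩ {z | |z.1 - z.2| ∈ Set.Ioc δ (2 * δ)}

lemma measurableSet_diagonalShell (δ : ℝ) : MeasurableSet (diagonalShell δ) :=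
  (measurableSet_Icc.prod measurableSet_Icc).inter
    ((continuous_abs.comp (continuous_fst.sub continuous_snd)).measurable measurableSet_Ioc)

lemma volume_diagonalShell_le {δ : ℝ} (hδ : 0 < δ) :
    volume (diagonalShell δ) ≤ ENNReal.ofReal (8 * δ) := by
  rw [Measure.volume_eq_prod, Measure.prod_apply (measurableSet_diagonalShell δ)]
  calc _ ≤ ∫⁻ ξ, (Set.Icc (-1 : ℝ) 1).indicator (fun _ ↦ ENNReal.ofReal (4 * δ)) ξ := by
        refine lintegral_mono fun ξ ↦ ?_
        by_cases hξ : ξ ∈ Set.Icc (-1 : ℝ) 1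
        · rw [Set.indicator_of_mem hξ]
          calc _ ≤ volume (Set.Icc (ξ - 2 * δ) (ξ + 2 * δ)) := by
                refine measure_mono fun η hη ↦ ?_
                have := abs_le.mp hη.2.2
                simp only at this
                constructor <;> linarith
            _ = _ := by
                rw [Real.volume_Icc]
                congr 1
                ring
        · have : Prod.mk ξ ⁻¹' diagonalShell δ = ∅ :=
            Set.eq_empty_of_forall_notMem fun η hη ↦ hξ hη.1.1
          simp [this]
    _ = ENNReal.ofReal (8 * δ) := by
        rw [lintegral_indicator measurableSet_Icc, setLIntegral_const, Real.volume_Icc,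
          ← ENNReal.ofReal_mul (by positivity)]
        congr 1
        ring

lemma setLIntegral_planeGaussianFourier_diagonalShell_le {δ b : ℝ} (hδ : 0 < δ) (hb : 0 < b)
    (w : ℝ × ℝ) :
    ∫⁻ z in diagonalShell δ, ENNReal.ofReal (planeGaussianFourier b (w - parabolaSum z)) ≤
      ENNReal.ofReal (1 / δ) := by
  have hg : ∫⁻ y, ENNReal.ofReal (planeGaussianFourier b (w - y)) = 1 := by
    rw [← lintegral_planeGaussianFourier hb]
    exact lintegral_sub_left_eq_self (fun y ↦ ENNReal.ofReal (planeGaussianFourier b y)) w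
  have half {T : Set (ℝ × ℝ)} (hT : MeasurableSet T) (hinj : Set.InjOn parabolaSum T) :
      ∫⁻ z in diagonalShell δ ∩ T,
        ENNReal.ofReal (planeGaussianFourier b (w - parabolaSum z)) ≤
        ENNReal.ofReal (1 / (2 * δ)) := by
    have := setLIntegral_comp_parabolaSum_le ((measurableSet_diagonalShell δ).inter hT)
      (hinj.mono Set.inter_subset_right) hδ (fun z hz ↦ hz.1.2.1.le)
      (fun y ↦ ENNReal.ofReal (planeGaussianFourier b (w - y)))
    rwa [hg, mul_one] at this
  have hcover : diagonalShell δ ⊆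
      (diagonalShell δ ∩ {z | z.1 < z.2}) ∪ (diagonalShell δ ∩ {z | z.2 < z.1}) := by
    intro z hz
    rcases lt_trichotomy z.1 z.2 with h | h | h
    · exact Or.inl ⟨hz, h⟩
    · have := hz.2.1
      rw [h, sub_self, abs_zero] at this
      linarith
    · exact Or.inr ⟨hz, h⟩
  calc _ ≤ _ := lintegral_mono_set hcover
    _ ≤ _ := lintegral_union_le _ _ _
    _ ≤ ENNReal.ofReal (1 / (2 * δ)) + ENNReal.ofReal (1 / (2 * δ)) :=
      add_le_add (half (measurableSet_lt measurable_fst measurable_snd) injOn_parabolaSum_lt)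
        (half (measurableSet_lt measurable_snd measurable_fst) injOn_parabolaSum_gt)
    _ = _ := by
      rw [← ENNReal.ofReal_add (by positivity) (by positivity)]
      congr 1
      field_simp
      norm_num

lemma pairwise_disjoint_diagonalShell :
    Pairwise (Function.onFun Disjoint fun k : ℕ ↦ diagonalShell ((1 / 2) ^ k)) := by
  refine (pairwise_disjoint_on _).2 fun m n hmn ↦ Set.disjoint_left.2 fun z hz hz' ↦ ?_
  have h1 := hz.2.1
  have h2 := hz'.2.2
  have h3 : ((1 : ℝ) / 2) ^ n ≤ (1 / 2) ^ (m + 1) :=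
    pow_le_pow_of_le_one (by norm_num) (by norm_num) hmn
  rw [pow_succ] at h3
  linarith

lemma iUnion_diagonalShell : ⋃ k : ℕ, diagonalShell ((1 / 2) ^ k) =
    (Set.Icc (-1) 1 ×ˢ Set.Icc (-1) 1) \ {z | z.1 = z.2} := by
  ext z
  simp only [Set.mem_iUnion]
  constructor
  · rintro ⟨k, hz⟩
    refine ⟨hz.1, fun h ↦ ?_⟩
    have h1 := hz.2.1
    rw [show z.1 = z.2 from h, sub_self, abs_zero] at h1
    exact absurd h1 (not_lt.2 (by positivity))
  · rintro ⟨hz, hne⟩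
    have hpos : 0 < |z.1 - z.2| := abs_pos.2 (sub_ne_zero.2 hne)
    have hle : |z.1 - z.2| ≤ 2 := by
      rw [abs_le]
      constructor <;> linarith [hz.1.1, hz.1.2, hz.2.1, hz.2.2]
    obtain ⟨k, hk1, hk2⟩ := exists_nat_pow_near_of_lt_one (x := |z.1 - z.2| / 2) (y := 1 / 2)
      (by positivity) (by linarith) (by norm_num) (by norm_num)
    refine ⟨k, hz, ?_, ?_⟩
    · rw [pow_succ] at hk1
      linarith
    · linarith

lemma volume_diagonal : volume {z : ℝ × ℝ | z.1 = z.2} = 0 := by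
  rw [Measure.volume_eq_prod,
    Measure.prod_apply (measurableSet_eq_fun measurable_fst measurable_snd)]
  simp

end SumMap

section Summation

/-- If `g k` is bounded by `B 2⁻ᵏ` and uniformly bounded in `L²`, then `∑ g k` is in `L^q`
for `q > 2`, with a quantitative bound. -/
lemma exists_lintegral_rpow_le_of_geometric {β : Type*} [MeasurableSpace β] (ν : Measure β)
    {q B : ℝ} (hq : 2 < q) (hB : 0 ≤ B) {D : ℝ≥0∞} (hD : D ≠ ∞) :
    ∃ C : ℝ≥0∞, C ≠ ∞ ∧ ∀ (g : ℕ → β → ℝ) (F : β → ℝ≥0∞), (∀ k, Measurable (g k)) →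
      (∀ k x, 0 ≤ g k x) → (∀ k x, g k x ≤ B * (1 / 2) ^ k) →
      (∀ k, ∫⁻ x, ENNReal.ofReal (g k x ^ 2) ∂ν ≤ D) →
      (∀ x, F x ≤ ∑' k, ENNReal.ofReal (g k x)) → ∫⁻ x, F x ^ q ∂ν ≤ C := by
  have hq0 : 0 < q := by linarith
  set s : ℝ := (1 / 2) ^ ((q - 2) / 2) with hs
  set r : ℝ := s ^ (1 / q) with hr
  have hs0 : 0 < s := by positivity
  have hs1 : s < 1 := Real.rpow_lt_one (by norm_num) (by norm_num) (by linarith)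
  have hr0 : 0 < r := by positivity
  have hr1 : r < 1 := Real.rpow_lt_one hs0.le hs1 (by positivity)
  have hrs (k : ℕ) : (r ^ k) ^ q = s ^ k := by
    rw [hr, ← Real.rpow_natCast, ← Real.rpow_natCast, ← Real.rpow_mul hs0.le,
      ← Real.rpow_mul hs0.le]
    congr 1
    field_simp
  have hss (k : ℕ) : (((1 : ℝ) / 2) ^ k) ^ (q - 2) = s ^ k * s ^ k := by
    rw [← pow_add, hs, ← Real.rpow_natCast, ← Real.rpow_natCast,
      ← Real.rpow_mul (by norm_num), ← Real.rpow_mul (by norm_num)]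
    congr 1
    push_cast
    ring
  have hgeo {t c : ℝ} (ht0 : 0 ≤ t) (ht1 : t < 1) (hc : 0 ≤ c) :
      ∑' k : ℕ, ENNReal.ofReal (c * t ^ k) ≠ ∞ :=
    ((summable_geometric_of_lt_one ht0 ht1).mul_left c).tsum_ofReal_ne_top
  refine ⟨(∑' k : ℕ, ENNReal.ofReal (1 * r ^ k)) ^ q *
    ((∑' k : ℕ, ENNReal.ofReal (B ^ (q - 2) * s ^ k)) * D), ?_, ?_⟩
  · exact ENNReal.mul_ne_top (ENNReal.rpow_ne_top_of_nonneg hq0.le (hgeo hr0.le hr1 zero_le_one))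
      (ENNReal.mul_ne_top (hgeo hs0.le hs1 (by positivity)) hD)
  intro g F hgm hg0 hgB hgD hF
  set W : ℝ≥0∞ := ∑' k : ℕ, ENNReal.ofReal (1 * r ^ k) with hW
  have hWtop : W ≠ ∞ := hgeo hr0.le hr1 zero_le_one
  let A (x : β) : ℝ≥0∞ := ∑' k, ENNReal.ofReal (g k x ^ q / s ^ k)
  have hgA (k : ℕ) (x : β) :
      ENNReal.ofReal (g k x) ≤ ENNReal.ofReal (1 * r ^ k) * A x ^ (1 / q) := by
    have hrk : 0 < r ^ k := by positivity
    have h1 : g k x = 1 * r ^ k * (g k x ^ q / s ^ k) ^ (1 / q) := by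
      rw [← hrs, ← Real.div_rpow (hg0 k x) hrk.le, one_div,
        Real.rpow_rpow_inv (div_nonneg (hg0 k x) hrk.le) hq0.ne']
      field_simp
    have hnn : 0 ≤ g k x ^ q / s ^ k := div_nonneg (Real.rpow_nonneg (hg0 k x) _) (by positivity)
    conv_lhs => rw [h1]
    rw [ENNReal.ofReal_mul (by positivity), ← ENNReal.ofReal_rpow_of_nonneg hnn (by positivity)]
    gcongr
    exact ENNReal.le_tsum (f := fun k ↦ ENNReal.ofReal (g k x ^ q / s ^ k)) k
  have hFA (x : β) : F x ^ q ≤ W ^ q * A x := by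
    have h1 : F x ≤ W * A x ^ (1 / q) := by
      refine (hF x).trans ?_
      rw [hW, ← ENNReal.tsum_mul_right]
      exact ENNReal.tsum_le_tsum fun k ↦ hgA k x
    calc F x ^ q ≤ (W * A x ^ (1 / q)) ^ q := by gcongr
      _ = W ^ q * A x := by
        rw [ENNReal.mul_rpow_of_nonneg _ _ hq0.le, one_div, ENNReal.rpow_inv_rpow hq0.ne']
  have hterm (k : ℕ) : ∫⁻ x, ENNReal.ofReal (g k x ^ q / s ^ k) ∂ν ≤
      ENNReal.ofReal (B ^ (q - 2) * s ^ k) * D := by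
    calc _ ≤ ∫⁻ x, ENNReal.ofReal (B ^ (q - 2) * s ^ k) * ENNReal.ofReal (g k x ^ 2) ∂ν := by
          refine lintegral_mono fun x ↦ ?_
          rw [← ENNReal.ofReal_mul (by positivity)]
          refine ENNReal.ofReal_le_ofReal ?_
          rw [div_le_iff₀ (by positivity)]
          have h1 : g k x ^ q = g k x ^ (q - 2) * g k x ^ 2 := by
            rw [← Real.rpow_natCast, ← Real.rpow_add_of_nonneg (hg0 k x) (by linarith)
              (by norm_num)]
            congr 1
            push_cast
            ring
          have h2 : g k x ^ (q - 2) ≤ B ^ (q - 2) * (s ^ k * s ^ k) := by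
            rw [← hss, ← Real.mul_rpow hB (by positivity)]
            exact Real.rpow_le_rpow (hg0 k x) (hgB k x) (by linarith)
          rw [h1]
          calc _ ≤ B ^ (q - 2) * (s ^ k * s ^ k) * g k x ^ 2 := by gcongr
            _ = _ := by ring
      _ = ENNReal.ofReal (B ^ (q - 2) * s ^ k) * ∫⁻ x, ENNReal.ofReal (g k x ^ 2) ∂ν :=
          lintegral_const_mul' _ _ ENNReal.ofReal_ne_top
      _ ≤ _ := by
          gcongr
          exact hgD k
  calc ∫⁻ x, F x ^ q ∂ν ≤ ∫⁻ x, W ^ q * A x ∂ν := lintegral_mono hFA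
    _ = W ^ q * ∫⁻ x, A x ∂ν :=
      lintegral_const_mul' _ _ (ENNReal.rpow_ne_top_of_nonneg hq0.le hWtop)
    _ ≤ _ := by
      gcongr
      rw [lintegral_tsum fun k ↦
        (((hgm k).pow_const q).div_const _).ennreal_ofReal.aemeasurable, ← ENNReal.tsum_mul_right]
      exact ENNReal.tsum_le_tsum hterm

end Summation

section Extension

/-- The Fourier extension of the density `a` from the truncated parabola. -/
noncomputable def parabolaExtension (a : ℝ → ℂ) (x : ℝ × ℝ) : ℂ :=
  ∫ ξ in Set.Icc (-1 : ℝ) 1, a ξ * planeChar x (ξ, ξ ^ 2)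

lemma parabolaExtension_sq (a : ℝ → ℂ) (x : ℝ × ℝ) :
    parabolaExtension a x ^ 2 =
      oscInt (volume.restrict (Set.Icc (-1 : ℝ) 1 ×ˢ Set.Icc (-1 : ℝ) 1)) parabolaSum
        (fun z ↦ a z.1 * a z.2) x := by
  rw [sq, parabolaExtension, ← setIntegral_prod_mul, ← Measure.volume_eq_prod, oscInt]
  congr 1 with z
  rw [show parabolaSum z = (z.1, z.1 ^ 2) + (z.2, z.2 ^ 2) from rfl, planeChar_add]
  ring

lemma measurable_parabolaExtension {a : ℝ → ℂ} (ha : Measurable a) :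
    Measurable (parabolaExtension a) :=
  (stronglyMeasurable_oscInt (μ := volume.restrict (Set.Icc (-1 : ℝ) 1))
    (Φ := fun ξ : ℝ ↦ (ξ, ξ ^ 2)) (by fun_prop) ha).measurable

lemma enorm_parabolaExtension_sq_le {a : ℝ → ℂ} (ha : Measurable a) (hb : ∀ ξ, ‖a ξ‖ ≤ 1)
    (x : ℝ × ℝ) :
    ‖parabolaExtension a x‖ₑ ^ 2 ≤ ∑' k : ℕ, ENNReal.ofReal
      ‖oscInt (volume.restrict (diagonalShell ((1 / 2) ^ k))) parabolaSum
        (fun z ↦ a z.1 * a z.2) x‖ := by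
  have hm : Measurable fun z : ℝ × ℝ ↦ a z.1 * a z.2 * planeChar x (parabolaSum z) :=
    ((ha.comp measurable_fst).mul (ha.comp measurable_snd)).mul
      ((measurable_planeChar_comp continuous_parabolaSum.measurable).comp
        (measurable_const.prodMk measurable_id))
  have hfin : volume (⋃ k : ℕ, diagonalShell ((1 / 2) ^ k)) ≠ ∞ := by
    rw [iUnion_diagonalShell]
    exact measure_ne_top_of_subset Set.sdiff_subset
      (isCompact_Icc.prod isCompact_Icc).measure_lt_top.ne
  have hint : IntegrableOn (fun z : ℝ × ℝ ↦ a z.1 * a z.2 * planeChar x (parabolaSum z))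
      (⋃ k : ℕ, diagonalShell ((1 / 2) ^ k)) := by
    refine Measure.integrableOn_of_bounded (M := 1) hfin hm.aestronglyMeasurable
      (Eventually.of_forall fun z ↦ ?_)
    rw [norm_mul, norm_mul, norm_planeChar, mul_one]
    exact mul_le_one₀ (hb _) (norm_nonneg _) (hb _)
  have hsq : parabolaExtension a x ^ 2 =
      ∑' k : ℕ, oscInt (volume.restrict (diagonalShell ((1 / 2) ^ k))) parabolaSum
        (fun z ↦ a z.1 * a z.2) x := by
    rw [parabolaExtension_sq]
    unfold oscInt
    rw [← integral_iUnion (fun k ↦ measurableSet_diagonalShell _) pairwise_disjoint_diagonalShell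
      hint, iUnion_diagonalShell]
    exact setIntegral_congr_set (sdiff_null_ae_eq_self volume_diagonal).symm
  rw [← enorm_pow, hsq]
  simp_rw [ofReal_norm]
  exact enorm_tsum_le_tsum_enorm

lemma exists_lintegral_parabolaExtension_le {p : ℝ} (hp : 4 < p) :
    ∃ C : ℝ≥0∞, C ≠ ∞ ∧ ∀ a : ℝ → ℂ, Measurable a → (∀ ξ, ‖a ξ‖ ≤ 1) →
      ∫⁻ x, ‖parabolaExtension a x‖ₑ ^ p ≤ C := by
  obtain ⟨C, hC, H⟩ := exists_lintegral_rpow_le_of_geometric (volume : Measure (ℝ × ℝ))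
    (q := p / 2) (B := 8) (D := 8) (by linarith) (by norm_num) (by norm_num)
  refine ⟨C, hC, fun a ha hb ↦ ?_⟩
  have hfin (k : ℕ) : IsFiniteMeasure (volume.restrict (diagonalShell ((1 / 2) ^ k))) :=
    ⟨by
      rw [Measure.restrict_apply_univ]
      exact (volume_diagonalShell_le (by positivity)).trans_lt ENNReal.ofReal_lt_top⟩
  have hmeas : Measurable fun z : ℝ × ℝ ↦ a z.1 * a z.2 :=
    (ha.comp measurable_fst).mul (ha.comp measurable_snd)
  have hbound (z : ℝ × ℝ) : ‖a z.1 * a z.2‖ ≤ 1 := by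
    rw [norm_mul]
    exact mul_le_one₀ (hb _) (norm_nonneg _) (hb _)
  have key := H (fun k x ↦ ‖oscInt (volume.restrict (diagonalShell ((1 / 2) ^ k))) parabolaSum
        (fun z ↦ a z.1 * a z.2) x‖) (fun x ↦ ‖parabolaExtension a x‖ₑ ^ 2)
    (fun k ↦ (stronglyMeasurable_oscInt continuous_parabolaSum.measurable hmeas).norm.measurable)
    (fun k x ↦ norm_nonneg _) (fun k x ↦ ?_) (fun k ↦ ?_)
    (enorm_parabolaExtension_sq_le ha hb)
  · refine le_of_eq_of_le (lintegral_congr fun x ↦ ?_) key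
    rw [← ENNReal.rpow_natCast, ← ENNReal.rpow_mul]
    congr 1
    push_cast
    ring
  · refine (norm_oscInt_le hbound x).trans ?_
    rw [measureReal_restrict_apply_univ]
    exact ENNReal.toReal_le_of_le_ofReal (by positivity) (volume_diagonalShell_le (by positivity))
  · refine (lintegral_oscInt_sq_le continuous_parabolaSum.measurable hmeas hbound fun b hb0 w ↦
      setLIntegral_planeGaussianFourier_diagonalShell_le (δ := (1 / 2) ^ k) (by positivity)
        hb0 w).trans ?_
    rw [Measure.restrict_apply_univ]
    calc _ ≤ ENNReal.ofReal (1 / (1 / 2) ^ k) * ENNReal.ofReal (8 * (1 / 2) ^ k) := by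
          gcongr
          exact volume_diagonalShell_le (by positivity)
      _ = 8 := by
          rw [← ENNReal.ofReal_mul (by positivity)]
          have : (1 : ℝ) / (1 / 2) ^ k * (8 * (1 / 2) ^ k) = 8 := by field_simp
          rw [this]
          norm_num

end Extension

end ParabolaRestriction

/-- Fefferman's restriction theorem in the plane: for measurable `a : [-1,1] → ℂ` with
`|a(ξ)| ≤ 1` and `f(x₁,x₂) = ∫_{-1}^1 a(ξ) e^{2πi(x₁ξ + x₂ξ²)} dξ`, for every `p > 4` one has
`‖f‖_{L^p(ℝ²)} ≤ C(p)` with `C(p)` independent of `a`. -/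
theorem fefferman_restriction_plane (p : ℝ) (hp : 4 < p) :
    ∃ C : ℝ, ∀ a : ℝ → ℂ, Measurable a → (∀ ξ ∈ Set.Icc (-1 : ℝ) 1, ‖a ξ‖ ≤ 1) →
      (∫ x : ℝ × ℝ,
          ‖∫ ξ in Set.Icc (-1 : ℝ) 1,
              a ξ * Complex.exp (2 * Real.pi * Complex.I *
                ((x.1 * ξ + x.2 * ξ ^ 2 : ℝ) : ℂ))‖ ^ p) ^ (1 / p)
        ≤ C := by
  obtain ⟨C, hC, H⟩ := ParabolaRestriction.exists_lintegral_parabolaExtension_le hp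
  refine ⟨C.toReal ^ (1 / p), fun a ha hb ↦ ?_⟩
  refine Real.rpow_le_rpow (integral_nonneg fun x ↦ by positivity) ?_ (by positivity)
  set a' : ℝ → ℂ := (Set.Icc (-1 : ℝ) 1).indicator a with ha'
  have hm' : Measurable a' := ha.indicator measurableSet_Icc
  have hb' (ξ : ℝ) : ‖a' ξ‖ ≤ 1 := by
    by_cases hξ : ξ ∈ Set.Icc (-1 : ℝ) 1
    · simpa [ha', hξ] using hb ξ hξ
    · simp [ha', hξ]
  have heq (x : ℝ × ℝ) : ∫ ξ in Set.Icc (-1 : ℝ) 1, a ξ * Complex.exp (2 * Real.pi * Complex.I *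
      ((x.1 * ξ + x.2 * ξ ^ 2 : ℝ) : ℂ)) = ParabolaRestriction.parabolaExtension a' x := by
    refine setIntegral_congr_fun measurableSet_Icc fun ξ hξ ↦ ?_
    simp only [ha', Set.indicator_of_mem hξ, ParabolaRestriction.planeChar]
  simp_rw [heq]
  rw [integral_eq_lintegral_of_nonneg_ae (Filter.Eventually.of_forall fun x ↦ by positivity)
    (((ParabolaRestriction.measurable_parabolaExtension hm').norm.pow_const
      p).aestronglyMeasurable)]
  refine ENNReal.toReal_mono hC (le_of_eq_of_le (lintegral_congr fun x ↦ ?_) (H a' hm' hb'))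
  rw [← ENNReal.ofReal_rpow_of_nonneg (norm_nonneg _) (by linarith), ofReal_norm]
end
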